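/- arXiv:1003.4465 — 6 statements merged into one kernel-verified Lean document; each statement's English description precedes it below -/
import Mathlib

section
/- Let K be a field of characteristic zero, p a prime, k ≥ 2 an integer, and β, β' ∈ K both nonzero. Put a := β + β', c := β·β', and B(p) := U(p) + c·p^{2(1−k)}·V(p) − a·p^{1−k}. Then for every coefficient sequence f : ℤ → K one has ((f|B(p))|U(p)) = c·p^{2(1−k)}·((f|(1 − β'^{−1}·p^{k−1}·U(p)))|(1 − β^{−1}·p^{k−1}·U(p))). -/
/-- (f|B(p))|U(p) = c·p^{2(1−k)}·((f|(1 − β'⁻¹p^{k−1}U(p)))|(1 − β⁻¹p^{k−1}U(p))). -/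
theorem stmt_1 (K : Type*) [Field K] [CharZero K] (p : ℕ) (hp : p.Prime)
    (k : ℤ) (hk : 2 ≤ k) (β β' : K) (hβ : β ≠ 0) (hβ' : β' ≠ 0)
    (U V : (ℤ → K) → (ℤ → K))
    (hU : ∀ (f : ℤ → K) (n : ℤ), U f n = f (p * n))
    (hV : ∀ (f : ℤ → K) (n : ℤ), V f n = if (p : ℤ) ∣ n then f (n / p) else 0)
    (f : ℤ → K) :
    U (fun m => U f m + (β * β') * (p : K) ^ (2 * (1 - k)) * V f m
        - (β + β') * (p : K) ^ (1 - k) * f m)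
      = fun n => (β * β') * (p : K) ^ (2 * (1 - k)) *
        ((fun m => (f m - β'⁻¹ * (p : K) ^ (k - 1) * U f m)
            - β⁻¹ * (p : K) ^ (k - 1) *
              U (fun m' => f m' - β'⁻¹ * (p : K) ^ (k - 1) * U f m') m) n) := by
  have hp0 : (p : K) ≠ 0 := Nat.cast_ne_zero.mpr hp.ne_zero
  have hpz : (p : ℤ) ≠ 0 := Nat.cast_ne_zero.mpr hp.ne_zero
  have hx : (p : K) ^ (k - 1) ≠ 0 := zpow_ne_zero _ hp0
  have hinv : (p : K) ^ (1 - k) = ((p : K) ^ (k - 1))⁻¹ := by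
    rw [← zpow_neg, neg_sub]
  have hsq : (p : K) ^ (2 * (1 - k)) = ((p : K) ^ (k - 1))⁻¹ ^ 2 := by
    rw [mul_comm, zpow_mul, hinv, zpow_ofNat]
  funext n
  simp only [hU, hV, dvd_mul_right, if_true, Int.mul_ediv_cancel_left _ hpz, hinv, hsq]
  generalize (p : K) ^ (k - 1) = x at hx
  field_simp
  ring
end

section
/- Let K be a field equipped with a multiplicative norm ‖·‖ satisfying the ultrametric inequality, let p be a prime whose image in K satisfies 0 < ‖p‖ < 1, let k ≥ 2 be an integer, and let β, β' ∈ K be nonzero with ‖β·β'‖ = ‖p‖^{k−1}. Assume that either ‖β'‖ < ‖β‖ or β' = −β. Then for every integer M ≥ 0, ‖p^{2M(1−k)}·Σ_{ℓ=0}^{2M} β^ℓ·β'^{2M−ℓ}‖ ≥ ‖p‖^{−M(k−1)}. In particular, since ‖p‖ < 1 and k ≥ 2, these norms tend to infinity with M; i.e., the coefficients at the indices n = p^{2M} of the Eichler integral E_g, which equal p^{2M(1−k)}·a_g(p^{2M}) with a_g(p^{2M}) = Σ_{ℓ=0}^{2M} β^ℓ β'^{2M−ℓ}, are p-adically unbounded.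 -/
/-- In an ultrametric field, subtracting an element of smaller norm does not change the norm. -/
theorem norm_sub_eq_left_of_norm_lt {K : Type*} [NormedField K]
    (hu : ∀ x y : K, ‖x + y‖ ≤ max ‖x‖ ‖y‖) {x y : K} (h : ‖y‖ < ‖x‖) :
    ‖x - y‖ = ‖x‖ := by
  apply le_antisymm
  · have := hu x (-y)
    rwa [norm_neg, max_eq_left h.le, ← sub_eq_add_neg] at this
  · have := hu (x - y) y
    rw [sub_add_cancel] at this
    exact (le_max_iff.mp this).resolve_right h.not_ge

/-- If `‖y‖ < ‖x‖`, the leading term `x ^ n` dominates the homogeneous geometric sum. -/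
theorem norm_geom_sum₂_of_norm_lt {K : Type*} [NormedField K]
    (hu : ∀ x y : K, ‖x + y‖ ≤ max ‖x‖ ‖y‖) {x y : K} (h : ‖y‖ < ‖x‖) (n : ℕ) :
    ‖∑ i ∈ Finset.range (n + 1), x ^ i * y ^ (n - i)‖ = ‖x‖ ^ n := by
  have hx : 0 < ‖x‖ := (norm_nonneg y).trans_lt h
  have hpow : ‖y ^ (n + 1)‖ < ‖x ^ (n + 1)‖ := by
    rw [norm_pow, norm_pow]
    exact pow_lt_pow_left₀ h (norm_nonneg y) n.succ_ne_zero
  have hgeom := congrArg norm ((Commute.all x y).geom_sum₂_mul (n + 1))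
  rw [norm_mul, norm_sub_eq_left_of_norm_lt hu h, norm_sub_eq_left_of_norm_lt hu hpow,
    norm_pow, pow_succ] at hgeom
  exact mul_right_cancel₀ hx.ne' hgeom

theorem geom_sum₂_neg_even {R : Type*} [CommRing R] (x : R) (m : ℕ) :
    ∑ i ∈ Finset.range (2 * m + 1), x ^ i * (-x) ^ (2 * m - i) = x ^ (2 * m) := by
  have hterm : ∀ i ∈ Finset.range (2 * m + 1),
      x ^ i * (-x) ^ (2 * m - i) = (-1) ^ i * x ^ (2 * m) := by
    intro i hi
    have hle : i ≤ 2 * m := Nat.lt_succ_iff.mp (Finset.mem_range.mp hi)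
    have hsign : (-1 : R) ^ (2 * m - i) = (-1) ^ i := by
      rcases Nat.even_or_odd i with h | h
      · rw [h.neg_one_pow, Even.neg_one_pow (by grind)]
      · rw [h.neg_one_pow, Odd.neg_one_pow (by grind)]
    rw [neg_pow, hsign, mul_left_comm, ← pow_add, Nat.add_sub_cancel' hle]
  rw [Finset.sum_congr rfl hterm, ← Finset.sum_mul, neg_one_geom_sum,
    if_neg (by grind), one_mul]

/-- Unboundedness of the coefficients p^{2M(1−k)}·a_g(p^{2M}) of the Eichler
integral: ‖p^{2M(1−k)}·Σ_{ℓ=0}^{2M} β^ℓ β'^{2M−ℓ}‖ ≥ ‖p‖^{−M(k−1)}. -/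
theorem stmt_6 (K : Type*) [NormedField K]
    (hu : ∀ x y : K, ‖x + y‖ ≤ max ‖x‖ ‖y‖)
    (p : ℕ) (hp : p.Prime) (hp0 : 0 < ‖(p : K)‖) (hp1 : ‖(p : K)‖ < 1)
    (k : ℤ) (hk : 2 ≤ k) (β β' : K) (hβ : β ≠ 0) (hβ' : β' ≠ 0)
    (hprod : ‖β * β'‖ = ‖(p : K)‖ ^ (k - 1))
    (hcase : ‖β'‖ < ‖β‖ ∨ β' = -β) :
    ∀ M : ℕ, ‖(p : K) ^ (2 * (M : ℤ) * (1 - k)) *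
        ∑ ℓ ∈ Finset.range (2 * M + 1), β ^ ℓ * β' ^ (2 * M - ℓ)‖
      ≥ ‖(p : K)‖ ^ (-(M : ℤ) * (k - 1)) := by
  intro M
  have hle : ‖β'‖ ≤ ‖β‖ := by
    rcases hcase with h | rfl
    · exact h.le
    · rw [norm_neg]
  have hsum : ‖∑ ℓ ∈ Finset.range (2 * M + 1), β ^ ℓ * β' ^ (2 * M - ℓ)‖ = ‖β‖ ^ (2 * M) := by
    rcases hcase with h | rfl
    · exact norm_geom_sum₂_of_norm_lt hu h (2 * M)
    · rw [geom_sum₂_neg_even, norm_pow]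
  have hbound : ‖(p : K)‖ ^ ((M : ℤ) * (k - 1)) ≤ ‖β‖ ^ (2 * M) := by
    rw [mul_comm, zpow_mul, zpow_natCast, ← hprod, norm_mul, pow_mul, sq]
    gcongr
  rw [norm_mul, norm_zpow, hsum, ge_iff_le]
  calc ‖(p : K)‖ ^ (-(M : ℤ) * (k - 1))
      = ‖(p : K)‖ ^ (2 * (M : ℤ) * (1 - k)) * ‖(p : K)‖ ^ ((M : ℤ) * (k - 1)) := by
        rw [← zpow_add₀ hp0.ne']
        congr 1
        ring
    _ ≤ ‖(p : K)‖ ^ (2 * (M : ℤ) * (1 - k)) * ‖β‖ ^ (2 * M) := by gcongr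
end

section
/- Let K be a complete nontrivially normed field (with multiplicative norm ‖·‖), p ≥ 2 an integer, and λ ∈ K with ‖λ‖ > 1. Let H, W : ℤ → K be coefficient sequences whose supports are bounded below (there is t such that H(n) = W(n) = 0 for all n < −t), suppose there is C ≥ 0 with ‖W(n)‖ ≤ C for all n ∈ ℤ, and suppose H satisfies the affine U(p)-recursion H(pn) = λ·H(n) + W(n) for all n ∈ ℤ. Then: (i) for every n ∈ ℤ the limit L(n) := lim_{m→∞} λ^{−m}·H(p^m n) exists in K; (ii) L satisfies L(pn) = λ·L(n) for all n ∈ ℤ; (iii) for every n ∈ ℤ the series Σ_{j=0}^{∞} λ^{−(j+1)}·W(p^j n) converges and H(n) = L(n) − Σ_{j=0}^{∞} λ^{−(j+1)}·W(p^j n); (iv) if moreover sup_{n∈ℤ} ‖H(n)‖ < ∞, then L is identically zero. -/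
/-- Telescoping of the affine recursion `H (p * n) = l * H n + W n`. -/
theorem sum_range_zpow_mul_of_affine_recursion {K : Type*} [Field K] {p : ℤ} {l : K}
    (hl : l ≠ 0) {H W : ℤ → K} (hrec : ∀ n : ℤ, H (p * n) = l * H n + W n) (n : ℤ) (m : ℕ) :
    ∑ j ∈ Finset.range m, l ^ (-((j : ℤ) + 1)) * W (p ^ j * n) =
      l ^ (-(m : ℤ)) * H (p ^ m * n) - H n := by
  induction m with
  | zero => simp
  | succ m ih =>
    have h : l ^ (-(m : ℤ)) = l ^ (-((m : ℤ) + 1)) * l := by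
      rw [← zpow_add_one₀ hl]
      congr 1
      ring
    rw [Finset.sum_range_succ, ih, pow_succ', mul_assoc, hrec, h]
    push_cast
    ring

theorem summable_zpow_neg_mul_of_bounded {K : Type*} [NormedField K] [CompleteSpace K]
    {l : K} (hl : 1 < ‖l‖) {w : ℕ → K} {C : ℝ} (hw : ∀ j, ‖w j‖ ≤ C) :
    Summable fun j : ℕ => l ^ (-((j : ℤ) + 1)) * w j := by
  have hgeom : Summable fun j : ℕ => ‖l‖⁻¹ ^ (j + 1) * C :=
    ((summable_nat_add_iff 1).2 (summable_geometric_of_lt_one (by positivity)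
      (inv_lt_one_of_one_lt₀ hl))).mul_right C
  refine hgeom.of_norm_bounded fun j => ?_
  have h : ‖l ^ (-((j : ℤ) + 1))‖ = ‖l‖⁻¹ ^ (j + 1) := by
    rw [norm_zpow, zpow_neg, inv_pow]
    norm_cast
  rw [norm_mul, h]
  gcongr
  exact hw j

theorem tendsto_zpow_neg_mul_of_bounded {K : Type*} [NormedField K] {l : K} (hl : 1 < ‖l‖)
    {h : ℕ → K} {C : ℝ} (hh : ∀ m, ‖h m‖ ≤ C) :
    Filter.Tendsto (fun m : ℕ => l ^ (-(m : ℤ)) * h m) Filter.atTop (nhds 0) := by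
  have hgeom : Filter.Tendsto (fun m : ℕ => ‖l‖⁻¹ ^ m * C) Filter.atTop (nhds 0) := by
    simpa using (tendsto_pow_atTop_nhds_zero_of_lt_one (by positivity)
      (inv_lt_one_of_one_lt₀ hl)).mul_const C
  refine squeeze_zero_norm (fun m => ?_) hgeom
  rw [norm_mul, norm_zpow, zpow_neg, zpow_natCast, inv_pow]
  gcongr
  exact hh m

/-- Affine U(p)-recursion H(pn) = λH(n) + W(n) with W bounded and ‖λ‖ > 1:
the limits L(n) = lim λ^{−m}H(p^m n) exist, L is a U(p)-eigenform with eigenvalue λ,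
H(n) = L(n) − Σ_{j≥0} λ^{−(j+1)}W(p^j n), and L = 0 if H is bounded. -/
theorem stmt_7 (K : Type*) [NontriviallyNormedField K] [CompleteSpace K]
    (p : ℕ) (hp : 2 ≤ p) (l : K) (hl : 1 < ‖l‖)
    (H W : ℤ → K) (t : ℤ)
    (hsupp : ∀ n : ℤ, n < -t → H n = 0 ∧ W n = 0)
    (C : ℝ) (hC : 0 ≤ C) (hW : ∀ n : ℤ, ‖W n‖ ≤ C)
    (hrec : ∀ n : ℤ, H (p * n) = l * H n + W n) :
    ∃ L : ℤ → K,
      (∀ n : ℤ, Filter.Tendsto (fun m : ℕ => l ^ (-(m : ℤ)) * H ((p : ℤ) ^ m * n))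
        Filter.atTop (nhds (L n))) ∧
      (∀ n : ℤ, L (p * n) = l * L n) ∧
      (∀ n : ℤ, HasSum (fun j : ℕ => l ^ (-((j : ℤ) + 1)) * W ((p : ℤ) ^ j * n)) (L n - H n)) ∧
      ((∃ C' : ℝ, ∀ n : ℤ, ‖H n‖ ≤ C') → ∀ n : ℤ, L n = 0) := by
  have hl0 : l ≠ 0 := norm_pos_iff.1 (one_pos.trans hl)
  have hsum (n : ℤ) := (summable_zpow_neg_mul_of_bounded hl
    (w := fun j => W ((p : ℤ) ^ j * n)) fun j => hW _).hasSum
  set S : ℤ → K := fun n => ∑' j : ℕ, l ^ (-((j : ℤ) + 1)) * W ((p : ℤ) ^ j * n)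
  have hlim (n : ℤ) : Filter.Tendsto (fun m : ℕ => l ^ (-(m : ℤ)) * H ((p : ℤ) ^ m * n))
      Filter.atTop (nhds (H n + S n)) := by
    refine ((hsum n).tendsto_sum_nat.const_add (H n)).congr fun m => ?_
    rw [sum_range_zpow_mul_of_affine_recursion hl0 hrec]
    ring
  refine ⟨fun n => H n + S n, hlim, fun n => ?_, fun n => ?_, ?_⟩
  · refine tendsto_nhds_unique (hlim (p * n))
      ((((Filter.tendsto_add_atTop_iff_nat 1).2 (hlim n)).const_mul l).congr fun m => ?_)
    have h : l ^ (-(m : ℤ)) = l * l ^ (-((m + 1 : ℕ) : ℤ)) := by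
      rw [← zpow_one_add₀ hl0]
      congr 1
      push_cast
      ring
    rw [h, pow_succ, mul_assoc (_ ^ m), mul_assoc]
  · rw [add_sub_cancel_left]
    exact hsum n
  · rintro ⟨C', hC'⟩ n
    exact tendsto_nhds_unique (hlim n) (tendsto_zpow_neg_mul_of_bounded hl fun m => hC' _)
end

section
/- Let K be a field with a multiplicative norm ‖·‖, p ≥ 2 an integer, and μ ∈ K with ‖μ‖ > 1. Let f : ℤ → K be a coefficient sequence whose support is bounded below (there is t such that f(n) = 0 for all n < −t), which is a U(p)-eigenform with eigenvalue μ, i.e. f(pn) = μ·f(n) for all n ∈ ℤ, and whose coefficients are bounded: sup_{n∈ℤ} ‖f(n)‖ < ∞. Then f is identically zero. -/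
/-- A bounded U(p)-eigenform with eigenvalue of norm > 1 and support
bounded below is identically zero. -/
theorem stmt_8 (K : Type*) [NormedField K] (p : ℕ) (hp : 2 ≤ p)
    (μ : K) (hμ : 1 < ‖μ‖) (f : ℤ → K) (t : ℤ)
    (hsupp : ∀ n : ℤ, n < -t → f n = 0)
    (heig : ∀ n : ℤ, f (p * n) = μ * f n)
    (hbdd : ∃ C : ℝ, ∀ n : ℤ, ‖f n‖ ≤ C) :
    ∀ n : ℤ, f n = 0 := by
  obtain ⟨C, hC⟩ := hbdd
  intro n
  by_contra hn
  have iterate (k : ℕ) : f ((p : ℤ) ^ k * n) = μ ^ k * f n := by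
    induction k with
    | zero => simp
    | succ k ih => rw [pow_succ', mul_assoc, heig, ih, pow_succ', mul_assoc]
  obtain ⟨k, hk⟩ := pow_unbounded_of_one_lt (C / ‖f n‖) hμ
  rw [div_lt_iff₀ (norm_pos_iff.mpr hn)] at hk
  have bound := hC ((p : ℤ) ^ k * n)
  rw [iterate, norm_mul, norm_pow] at bound
  exact absurd hk bound.not_gt
end

section
/- Let p be a prime, k ≥ 2 and C ≥ 1 and m ≥ 1 integers such that ℓ := C·p^{m−1}·(p−1) − (k−1) > 0. Let B ≥ 0 be a real number and let c : {n ∈ ℤ : n ≥ 1} → ℚ_p be a sequence with ‖c(n)‖_p ≤ B for all n and c(n) = 0 whenever p ∣ n. Then for every n ≥ 1 coprime to p, ‖(n : ℚ_p)^{1−k}·c(n) − (n : ℚ_p)^{ℓ}·c(n)‖_p ≤ B·p^{−m}. (Hence the formal series with coefficients n^{1−k}c(n) is congruent modulo p^m, up to the factor B, to the formal series with coefficients n^{ℓ}c(n), i.e. to D^{ℓ} applied to the series with coefficients c(n).) -/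
/-- **Euler's theorem** for an integer base. -/
theorem Int.ModEq.pow_totient_of_isCoprime {a : ℤ} {n : ℕ} (h : IsCoprime a n) :
    a ^ n.totient ≡ 1 [ZMOD n] := by
  rw [← ZMod.intCast_eq_intCast_iff]
  have hu : IsUnit (a : ZMod n) := by
    simpa [isCoprime_zero_right] using h.map (Int.castRingHom (ZMod n))
  obtain ⟨u, hu⟩ := hu
  push_cast
  rw [← hu, ← Units.val_pow_eq_pow_val, ZMod.pow_totient, Units.val_one]

/-- If `p` does not divide `n`, then `n ^ (C * φ(p ^ m))` is `p`-adically within `p ^ (-m)` of `1`. -/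
theorem Padic.norm_one_sub_intCast_pow_mul_totient_le (p : ℕ) [hp : Fact p.Prime] {n : ℤ}
    (hn : ¬ (p : ℤ) ∣ n) (C m : ℕ) :
    ‖1 - (n : ℚ_[p]) ^ (C * (p ^ m).totient)‖ ≤ (p : ℝ) ^ (-(m : ℤ)) := by
  have hcop : IsCoprime n ((p ^ m : ℕ) : ℤ) := by
    push_cast
    exact (((Nat.prime_iff_prime_int.mp hp.out).coprime_iff_not_dvd.mpr hn).symm).pow_right
  have hmod : n ^ (C * (p ^ m).totient) ≡ 1 [ZMOD (p ^ m : ℕ)] := by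
    simpa [mul_comm C, pow_mul] using (Int.ModEq.pow_totient_of_isCoprime hcop).pow C
  have hdvd := (Padic.norm_int_le_pow_iff_dvd (p := p) _ m).mpr (by exact_mod_cast hmod.dvd)
  simpa using hdvd


/-- The key congruence E_g ≡ D^{ℓ}(g) (mod p^m): for n coprime to p,
‖n^{1−k}c(n) − n^{ℓ}c(n)‖_p ≤ B·p^{−m}, where ℓ = C·p^{m−1}(p−1) − (k−1) > 0. -/
theorem stmt_11 (p : ℕ) [Fact p.Prime] (k C m : ℕ) (hk : 2 ≤ k) (hC : 1 ≤ C) (hm : 1 ≤ m)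
    (ℓ : ℤ) (hℓ : ℓ = (C : ℤ) * (p : ℤ) ^ (m - 1) * ((p : ℤ) - 1) - ((k : ℤ) - 1))
    (hℓpos : 0 < ℓ)
    (B : ℝ) (hB : 0 ≤ B) (c : ℤ → ℚ_[p])
    (hbound : ∀ n : ℤ, 1 ≤ n → ‖c n‖ ≤ B)
    (hvanish : ∀ n : ℤ, 1 ≤ n → (p : ℤ) ∣ n → c n = 0) :
    ∀ n : ℤ, 1 ≤ n → ¬ (p : ℤ) ∣ n →
      ‖(n : ℚ_[p]) ^ (1 - (k : ℤ)) * c n - (n : ℚ_[p]) ^ ℓ * c n‖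
        ≤ B * (p : ℝ) ^ (-(m : ℤ)) := by
  intro n hn hpn
  have hn0 : (n : ℚ_[p]) ≠ 0 := by
    exact_mod_cast (by lia : n ≠ 0)
  have hp1 : 1 ≤ p := (Fact.out : p.Prime).one_le
  have hexp : ℓ = (1 - (k : ℤ)) + ((C * (p ^ m).totient : ℕ) : ℤ) := by
    rw [hℓ, Nat.totient_prime_pow Fact.out hm]
    push_cast [hp1]
    ring
  have hnorm : ‖(n : ℚ_[p]) ^ (1 - (k : ℤ))‖ = 1 := by
    have h1 : ‖(n : ℚ_[p])‖ = 1 :=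
      (Padic.norm_int_le_one n).antisymm (not_lt.mp (mt Padic.norm_intCast_lt_one_iff.mp hpn))
    rw [norm_zpow, h1, one_zpow]
  have hfactor : (n : ℚ_[p]) ^ (1 - (k : ℤ)) * c n - (n : ℚ_[p]) ^ ℓ * c n
      = (n : ℚ_[p]) ^ (1 - (k : ℤ)) * (c n * (1 - (n : ℚ_[p]) ^ (C * (p ^ m).totient))) := by
    rw [hexp, zpow_add₀ hn0, zpow_natCast]
    ring
  rw [hfactor, norm_mul, hnorm, one_mul, norm_mul]
  gcongr
  · exact hbound n hn
  · exact Padic.norm_one_sub_intCast_pow_mul_totient_le p hpn C m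
end

section
/- Let K be a field with a multiplicative norm ‖·‖, p ≥ 2 an integer, and λ, λ' ∈ K with ‖λ‖ > ‖λ'‖ > 0. Let G, G' : ℤ → K satisfy G(pn) = λ·G(n) and G'(pn) = λ'·G'(n) for all n ∈ ℤ, with neither G nor G' identically zero. Let F : ℤ → K and L, L' ∈ K be such that for every n ∈ ℤ, lim_{m→∞} λ^{−m}·F(p^m n) = L·G(n) and lim_{m→∞} λ'^{−m}·(F − L·G)(p^m n) = L'·G'(n). Then the pair (γ, δ) = (L, L') is the unique pair in K × K such that for every n ∈ ℤ the limit lim_{m→∞} λ'^{−m}·(F − γ·G − δ·G')(p^m n) exists and equals 0. -/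
open Filter Topology in
/-- If `c * r ^ m + d` converges with `1 < ‖r‖`, then `c = 0`. -/
theorem eq_zero_of_tendsto_mul_pow_add {K : Type*} [NormedField K] {r c d e : K}
    (hr : 1 < ‖r‖) (h : Tendsto (fun m : ℕ => c * r ^ m + d) atTop (𝓝 e)) : c = 0 := by
  have hr0 : r ≠ 0 := norm_pos_iff.mp (zero_lt_one.trans hr)
  have hinv : Tendsto (fun m : ℕ => r⁻¹ ^ m) atTop (𝓝 0) :=
    tendsto_pow_atTop_nhds_zero_of_norm_lt_one (by
      rw [norm_inv]
      exact inv_lt_one_of_one_lt₀ hr)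
  have hc := (h.sub_const d).mul hinv
  rw [mul_zero] at hc
  refine tendsto_nhds_unique (tendsto_const_nhds.congr fun m => ?_) hc
  rw [inv_pow, add_sub_cancel_right, mul_assoc, mul_inv_cancel₀ (pow_ne_zero m hr0), mul_one]

/-- Iterating the eigenvalue relation `f (p * n) = a * f n`. -/
theorem apply_pow_mul_of_apply_mul {K : Type*} [Monoid K] {p : ℤ} {a : K} {f : ℤ → K}
    (hf : ∀ n, f (p * n) = a * f n) (m : ℕ) (n : ℤ) : f (p ^ m * n) = a ^ m * f n := by
  induction m with
  | zero => simp
  | succ m ih => rw [pow_succ', mul_assoc, hf, ih, pow_succ', mul_assoc]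

/-- Uniqueness of the pair (α, δ): with G, G' nonzero U(p)-eigenforms with
eigenvalues λ, λ' (‖λ‖ > ‖λ'‖ > 0), if lim λ^{−m}F(p^m n) = L·G(n) and
lim λ'^{−m}(F − LG)(p^m n) = L'·G'(n), then (γ, δ) = (L, L') is the unique pair with
lim λ'^{−m}(F − γG − δG')(p^m n) = 0 for all n. -/
theorem stmt_14 (K : Type*) [NormedField K] (p : ℕ) (hp : 2 ≤ p)
    (l l' : K) (hll' : ‖l'‖ < ‖l‖) (hl' : 0 < ‖l'‖)
    (G G' F : ℤ → K)
    (hGeig : ∀ n : ℤ, G (p * n) = l * G n)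
    (hG'eig : ∀ n : ℤ, G' (p * n) = l' * G' n)
    (hG0 : G ≠ 0) (hG'0 : G' ≠ 0)
    (L L' : K)
    (h1 : ∀ n : ℤ, Filter.Tendsto (fun m : ℕ => l ^ (-(m : ℤ)) * F ((p : ℤ) ^ m * n))
      Filter.atTop (nhds (L * G n)))
    (h2 : ∀ n : ℤ, Filter.Tendsto (fun m : ℕ => l' ^ (-(m : ℤ)) *
      (F ((p : ℤ) ^ m * n) - L * G ((p : ℤ) ^ m * n)))
      Filter.atTop (nhds (L' * G' n))) :
    ∀ γ δ : K,
      (∀ n : ℤ, Filter.Tendsto (fun m : ℕ => l' ^ (-(m : ℤ)) *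
        (F ((p : ℤ) ^ m * n) - γ * G ((p : ℤ) ^ m * n) - δ * G' ((p : ℤ) ^ m * n)))
        Filter.atTop (nhds 0)) ↔ (γ = L ∧ δ = L') := by
  intro γ δ
  have hl'0 : l' ≠ 0 := norm_pos_iff.mp hl'
  have hr : 1 < ‖l / l'‖ := by rwa [norm_div, one_lt_div hl']
  constructor
  · intro h
    have key (n : ℤ) : Filter.Tendsto
        (fun m : ℕ => ((γ - L) * G n) * (l / l') ^ m + δ * G' n)
        Filter.atTop (nhds (L' * G' n)) := by
      have hsub := (h2 n).sub (h n)
      rw [sub_zero] at hsub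
      refine hsub.congr fun m => ?_
      rw [apply_pow_mul_of_apply_mul hGeig, apply_pow_mul_of_apply_mul hG'eig,
        zpow_neg, zpow_natCast, div_pow]
      field_simp
      ring
    obtain ⟨n, hn⟩ := Function.ne_iff.mp hG0
    have hγ : γ - L = 0 :=
      (mul_eq_zero.mp (eq_zero_of_tendsto_mul_pow_add hr (key n))).resolve_right hn
    refine ⟨sub_eq_zero.mp hγ, ?_⟩
    obtain ⟨k, hk⟩ := Function.ne_iff.mp hG'0
    have hconst := key k
    simp only [hγ, zero_mul, zero_add] at hconst
    exact mul_right_cancel₀ hk (tendsto_nhds_unique tendsto_const_nhds hconst)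
  · rintro ⟨rfl, rfl⟩ n
    have hsub := (h2 n).sub_const (δ * G' n)
    rw [sub_self] at hsub
    refine hsub.congr fun m => ?_
    rw [apply_pow_mul_of_apply_mul hG'eig, zpow_neg, zpow_natCast]
    field_simp
end
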